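/- arXiv:1203.3569 — 2 statements merged into one kernel-verified Lean document; each statement's English description precedes it below -/
import Mathlib

section
/- Let H(q,p) : ℝ^d × ℝ^d → ℝ be a C² autonomous Hamiltonian satisfying: ‖d²H‖ ≤ M everywhere; ∂²_{pp} H ≥ m·Id in the sense of quadratic forms everywhere; and (m/2)|p|² − M ≤ H(q,p) ≤ (M/2)|p|² + M everywhere, with constants 0 < m ≤ M. Let a ∈ ℝ and suppose there exists a sub-solution at level a. Then there exists a C^{1,1} sub-solution at level a, i.e. a function v : ℝ^d → ℝ, differentiable with Lipschitz differential, such that H(q, dv(q)) ≤ a for all q. Moreover, for every sub-solution u at level a and every ε > 0, there exists a C^{1,1} sub-solution v at level a with |v(q) − u(q)| ≤ ε for all q ∈ ℝ^d. -/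
open scoped RealInnerProductSpace NNReal
open Set

open Filter Topology MeasureTheory

section SecondDifferences

variable {E : Type*} [NormedAddCommGroup E] [NormedSpace ℝ E]

/-- A locally bounded function with quadratically small second differences at a point has an
affine approximation there, with a quadratic error. -/
theorem exists_affine_approx_of_second_difference {g : E → ℝ} {K r B : ℝ}
    (h2 : ∀ x h, |g (x + h) + g (x - h) - 2 * g x| ≤ K * ‖h‖ ^ 2) (h0 : g 0 = 0)
    (hr : 0 < r) (hb : ∀ h, ‖h‖ ≤ r → |g h| ≤ B) :
    ∃ D : E →L[ℝ] ℝ, ∀ h, |g h - D h| ≤ K * ‖h‖ ^ 2 := by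
  set G : E → ℕ → ℝ := fun h n => 2 ^ n * g ((1 / 2 : ℝ) ^ n • h) with hG
  have hsum : ∀ a b n, |G a n + G b n - G (a + b) (n + 1)|
      ≤ K * ‖a - b‖ ^ 2 / 4 * (1 / 2) ^ n := by
    intro a b n
    have e1 : (1 / 2 : ℝ) ^ (n + 1) • (a + b) + (1 / 2 : ℝ) ^ (n + 1) • (a - b)
        = (1 / 2 : ℝ) ^ n • a := by
      rw [pow_succ]; module
    have e2 : (1 / 2 : ℝ) ^ (n + 1) • (a + b) - (1 / 2 : ℝ) ^ (n + 1) • (a - b)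
        = (1 / 2 : ℝ) ^ n • b := by
      rw [pow_succ]; module
    have h := h2 ((1 / 2 : ℝ) ^ (n + 1) • (a + b)) ((1 / 2 : ℝ) ^ (n + 1) • (a - b))
    rw [e1, e2, norm_smul, Real.norm_of_nonneg (by positivity)] at h
    have e3 : G a n + G b n - G (a + b) (n + 1) = 2 ^ n * (g ((1 / 2 : ℝ) ^ n • a)
        + g ((1 / 2 : ℝ) ^ n • b) - 2 * g ((1 / 2 : ℝ) ^ (n + 1) • (a + b))) := by
      simp only [hG]; ring
    rw [e3, abs_mul, abs_of_nonneg (by positivity : (0 : ℝ) ≤ 2 ^ n)]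
    refine (mul_le_mul_of_nonneg_left h (by positivity)).trans_eq ?_
    have e4 : (2 : ℝ) ^ n * (1 / 2) ^ n = 1 := by rw [← mul_pow]; norm_num
    rw [pow_succ]
    linear_combination (K * ‖a - b‖ ^ 2 / 4 * (1 / 2) ^ n) * e4
  have hstep : ∀ h n, dist (G h n) (G h (n + 1)) ≤ K * ‖h‖ ^ 2 / 4 * (1 / 2) ^ n := by
    intro h n
    have := hsum h 0 n
    rw [add_zero, sub_zero] at this
    have z : G 0 n = 0 := by simp [hG, h0]
    rwa [z, add_zero, ← Real.dist_eq] at this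
  have hlim : ∀ h, ∃ l, Tendsto (G h) atTop (𝓝 l) := fun h =>
    cauchySeq_tendsto_of_complete (cauchySeq_of_le_geometric _ _ (by norm_num) (hstep h))
  choose D hD using hlim
  have hDg : ∀ h, |g h - D h| ≤ K * ‖h‖ ^ 2 / 2 := by
    intro h
    have := dist_le_of_le_geometric_of_tendsto₀ _ _ (by norm_num) (hstep h) (hD h)
    have e : G h 0 = g h := by simp [hG]
    rw [e, Real.dist_eq] at this
    norm_num at this ⊢
    linarith
  have hadd : ∀ a b, D (a + b) = D a + D b := by
    intro a b
    have l1 : Tendsto (fun n => G a n + G b n - G (a + b) (n + 1)) atTop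
        (𝓝 (D a + D b - D (a + b))) :=
      ((hD a).add (hD b)).sub ((hD (a + b)).comp (tendsto_add_atTop_nat 1))
    have l2 : Tendsto (fun n : ℕ => K * ‖a - b‖ ^ 2 / 4 * (1 / 2 : ℝ) ^ n) atTop (𝓝 0) := by
      simpa using (tendsto_pow_atTop_nhds_zero_of_lt_one (r := (1 / 2 : ℝ)) (by norm_num)
        (by norm_num)).const_mul (K * ‖a - b‖ ^ 2 / 4)
    have := tendsto_nhds_unique l1 (squeeze_zero_norm (hsum a b) l2)
    linarith
  have hcont : Continuous (AddMonoidHom.mk' D hadd) := by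
    refine AddMonoidHom.continuous_of_isBounded_nhds_zero _ (Metric.closedBall_mem_nhds 0 hr) ?_
    refine (isBounded_iff_forall_norm_le.2 ⟨B + |K| * r ^ 2, ?_⟩)
    rintro _ ⟨h, hh, rfl⟩
    rw [mem_closedBall_zero_iff] at hh
    have a1 := hb h hh
    have a2 := hDg h
    have a3 : K * ‖h‖ ^ 2 ≤ |K| * r ^ 2 := by
      gcongr
      exact le_abs_self K
    have a4 : 0 ≤ |K| * r ^ 2 := by positivity
    simp only [AddMonoidHom.mk'_apply, Real.norm_eq_abs]
    grind
  refine ⟨(AddMonoidHom.mk' D hadd).toRealLinearMap hcont, fun h => ?_⟩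
  have := hDg h
  have a4 := abs_nonneg (g h - D h)
  simp only [AddMonoidHom.coe_toRealLinearMap, AddMonoidHom.mk'_apply]
  linarith

theorem exists_fderiv_of_second_difference {f : E → ℝ} {K : ℝ}
    (h2 : ∀ x h, |f (x + h) + f (x - h) - 2 * f x| ≤ K * ‖h‖ ^ 2)
    (hb : ∀ x, ∃ r > 0, ∃ B, ∀ h, ‖h‖ ≤ r → |f (x + h)| ≤ B) :
    ∃ D : E → E →L[ℝ] ℝ, ∀ x h, |f (x + h) - f x - D x h| ≤ K * ‖h‖ ^ 2 := by
  have key : ∀ x, ∃ D : E →L[ℝ] ℝ, ∀ h, |f (x + h) - f x - D h| ≤ K * ‖h‖ ^ 2 := by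
    intro x
    obtain ⟨r, hr, B, hB⟩ := hb x
    refine exists_affine_approx_of_second_difference (g := fun h => f (x + h) - f x)
      (B := B + |f x|) (fun y h => ?_) (by simp) hr (fun h hh => ?_)
    · have := h2 (x + y) h
      rw [show x + (y + h) = x + y + h by abel, show x + (y - h) = x + y - h by abel]
      rwa [show f (x + y + h) - f x + (f (x + y - h) - f x) - 2 * (f (x + y) - f x)
        = f (x + y + h) + f (x + y - h) - 2 * f (x + y) by ring]
    · exact (abs_sub _ _).trans (by gcongr; exact hB h hh)
  choose D hD using key
  exact ⟨D, hD⟩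

theorem hasFDerivAt_of_affine_approx {f : E → ℝ} {K : ℝ} {D : E →L[ℝ] ℝ} {x : E}
    (hD : ∀ h, |f (x + h) - f x - D h| ≤ K * ‖h‖ ^ 2) : HasFDerivAt f D x := by
  rw [hasFDerivAt_iff_isLittleO_nhds_zero]
  refine Asymptotics.IsBigO.trans_isLittleO (g := fun h : E => ‖h‖ ^ 2) ?_ ?_
  · refine Asymptotics.IsBigO.of_bound K (Eventually.of_forall fun h => ?_)
    rw [Real.norm_eq_abs, Real.norm_of_nonneg (by positivity)]
    exact hD h
  · exact Asymptotics.isLittleO_norm_pow_id one_lt_two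

theorem norm_sub_le_of_affine_approx {f : E → ℝ} {K : ℝ} {D : E → E →L[ℝ] ℝ}
    (hD : ∀ x h, |f (x + h) - f x - D x h| ≤ K * ‖h‖ ^ 2) (hK : 0 ≤ K) (x y : E) :
    ‖D x - D y‖ ≤ 8 * K * ‖x - y‖ := by
  rcases eq_or_ne x y with rfl | hxy
  · simp
  have hpos : 0 < ‖x - y‖ := norm_pos_iff.2 (sub_ne_zero.2 hxy)
  refine ContinuousLinearMap.opNorm_le_of_shell' (ε := 2 * ‖x - y‖) (c := 1 / 2) (by positivity)
    (by positivity) (by norm_num) fun h h1 h2 => ?_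
  have hn : ‖h‖ ≤ 2 * ‖x - y‖ := h2.le
  have hn' : ‖x - y‖ ≤ ‖h‖ := by norm_num at h1; linarith
  have a1 := hD x h
  have a2 := hD y (x - y + h)
  have a3 := hD y (x - y)
  rw [show y + (x - y + h) = x + h by abel, map_add] at a2
  rw [show y + (x - y) = x by abel] at a3
  have t : ‖x - y + h‖ ≤ ‖x - y‖ + ‖h‖ := norm_add_le _ _
  rw [sub_apply, Real.norm_eq_abs]
  have b1 : ‖x - y + h‖ ^ 2 ≤ (‖x - y‖ + ‖h‖) ^ 2 := by gcongr
  have b2 : K * ‖x - y + h‖ ^ 2 ≤ K * (‖x - y‖ + ‖h‖) ^ 2 := by gcongr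
  have : K * ‖h‖ ^ 2 + K * (‖x - y‖ + ‖h‖) ^ 2 + K * ‖x - y‖ ^ 2 ≤ 8 * K * ‖x - y‖ * ‖h‖ := by
    have : ‖h‖ ^ 2 + (‖x - y‖ + ‖h‖) ^ 2 + ‖x - y‖ ^ 2 ≤ 8 * ‖x - y‖ * ‖h‖ := by
      nlinarith [mul_le_mul_of_nonneg_right hn (norm_nonneg h),
        mul_le_mul_of_nonneg_left hn' hpos.le]
    nlinarith
  grind

theorem continuous_of_second_difference {f : E → ℝ} {K : ℝ}
    (h2 : ∀ x h, |f (x + h) + f (x - h) - 2 * f x| ≤ K * ‖h‖ ^ 2)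
    (hb : ∀ x, ∃ r > 0, ∃ B, ∀ h, ‖h‖ ≤ r → |f (x + h)| ≤ B) : Continuous f := by
  obtain ⟨D, hD⟩ := exists_fderiv_of_second_difference h2 hb
  exact continuous_iff_continuousAt.2 fun x =>
    (hasFDerivAt_of_affine_approx (hD x)).continuousAt

end SecondDifferences

section Taylor

variable {E : Type*} [NormedAddCommGroup E] [NormedSpace ℝ E]

/-- Second order Taylor inequality. -/
theorem taylor_lower_bound {f : E → ℝ} (hf : ContDiff ℝ 2 f) {z w : E} {c : ℝ}
    (hc : ∀ y, c ≤ fderiv ℝ (fderiv ℝ f) y w w) :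
    f z + fderiv ℝ f z w + c / 2 ≤ f (z + w) := by
  have hline : ∀ t : ℝ, HasDerivAt (fun t : ℝ => z + t • w) w t := fun t => by
    simpa using ((hasDerivAt_id t).smul_const w).const_add z
  have hdf : ∀ y, HasFDerivAt f (fderiv ℝ f y) y := fun y =>
    (hf.differentiable (by norm_num) y).hasFDerivAt
  have hdf2 : ∀ y, HasFDerivAt (fderiv ℝ f) (fderiv ℝ (fderiv ℝ f) y) y := fun y =>
    ((hf.fderiv_right (m := 1) (by norm_num)).differentiable (by norm_num) y).hasFDerivAt
  have d1 : ∀ t : ℝ, HasDerivAt (fun t : ℝ => f (z + t • w)) (fderiv ℝ f (z + t • w) w) t :=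
    fun t => (hdf _).comp_hasDerivAt t (hline t)
  have d2 : ∀ t : ℝ, HasDerivAt (fun t : ℝ => fderiv ℝ f (z + t • w) w)
      (fderiv ℝ (fderiv ℝ f) (z + t • w) w w) t := fun t =>
    ((ContinuousLinearMap.apply ℝ ℝ w).hasFDerivAt.comp_hasDerivAt t
      ((hdf2 _).comp_hasDerivAt t (hline t)))
  have m1 : Monotone fun t : ℝ => fderiv ℝ f (z + t • w) w - c * t := by
    have dd : ∀ t, HasDerivAt (fun t : ℝ => fderiv ℝ f (z + t • w) w - c * t)
        (fderiv ℝ (fderiv ℝ f) (z + t • w) w w - c) t := fun t => by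
      exact ((d2 t).sub ((hasDerivAt_id t).const_mul c)).congr_deriv (by simp)
    refine monotone_of_deriv_nonneg (fun t => (dd t).differentiableAt) fun t => ?_
    rw [(dd t).deriv]
    linarith [hc (z + t • w)]
  have m2 : MonotoneOn (fun t : ℝ => f (z + t • w) - fderiv ℝ f z w * t - c / 2 * t ^ 2)
      (Icc 0 1) := by
    have dd : ∀ t, HasDerivAt
        (fun t : ℝ => f (z + t • w) - fderiv ℝ f z w * t - c / 2 * t ^ 2)
        (fderiv ℝ f (z + t • w) w - fderiv ℝ f z w - c * t) t := fun t => by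
      refine (((d1 t).sub ((hasDerivAt_id t).const_mul _)).sub
        ((hasDerivAt_pow 2 t).const_mul (c / 2))).congr_deriv ?_
      simp; ring
    refine monotoneOn_of_deriv_nonneg (convex_Icc 0 1)
      (fun t _ => (dd t).continuousAt.continuousWithinAt)
      (fun t _ => (dd t).differentiableAt.differentiableWithinAt) fun t ht => ?_
    rw [interior_Icc] at ht
    rw [(dd t).deriv]
    have := m1 ht.1.le
    simp only [zero_smul, add_zero, mul_zero] at this
    linarith
  have := m2 (left_mem_Icc.2 zero_le_one) (right_mem_Icc.2 zero_le_one) zero_le_one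
  simp only [zero_smul, add_zero, one_smul] at this
  linarith

theorem second_difference_lower_bound {f : E → ℝ} (hf : ContDiff ℝ 2 f) {z w : E} {c : ℝ}
    (hc : ∀ y, c ≤ fderiv ℝ (fderiv ℝ f) y w w) :
    c ≤ f (z + w) + f (z - w) - 2 * f z := by
  have h1 := taylor_lower_bound hf (z := z) hc
  have h2 := taylor_lower_bound hf (z := z) (w := -w) (c := c) (by simpa using hc)
  rw [map_neg, ← sub_eq_add_neg, ← sub_eq_add_neg] at h2
  linarith

end Taylor

section Lagrangian

variable {E : Type*} [NormedAddCommGroup E] [InnerProductSpace ℝ E]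

/-- Quantitative form of `‖d²H‖ ≤ M`, `∂²_{pp} H ≥ m` and the quadratic growth of `H`, expressed
through second differences. -/
structure IsTonelliHamiltonian (H : E → E → ℝ) (m M : ℝ) : Prop where
  pos : 0 < m
  le : m ≤ M
  lower : ∀ q p, m / 2 * ‖p‖ ^ 2 - M ≤ H q p
  upper : ∀ q p, H q p ≤ M / 2 * ‖p‖ ^ 2 + M
  second_le : ∀ q h p k, H (q + h) (p + k) + H (q - h) (p - k) - 2 * H q p
    ≤ M * (‖h‖ ^ 2 + ‖k‖ ^ 2)
  le_second : ∀ q h p k, m * ‖k‖ ^ 2 - 2 * M * ‖h‖ * ‖k‖ - M * ‖h‖ ^ 2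
    ≤ H (q + h) (p + k) + H (q - h) (p - k) - 2 * H q p

/-- Quantitative regularity, growth and convexity in the velocity of a Lagrangian. -/
structure IsTonelliLagrangian (L : E → E → ℝ) (c C : ℝ) : Prop where
  pos : 0 < c
  nonneg : 0 ≤ C
  continuous : Continuous fun x : E × E => L x.1 x.2
  bound : ∀ q v, |L q v| ≤ C * (1 + ‖v‖ ^ 2)
  second_le : ∀ q h v k, L (q + h) (v + k) + L (q - h) (v - k) - 2 * L q v
    ≤ C * (‖h‖ ^ 2 + ‖k‖ ^ 2)
  le_second : ∀ q h v k, c * ‖k‖ ^ 2 - C * ‖h‖ ^ 2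
    ≤ L (q + h) (v + k) + L (q - h) (v - k) - 2 * L q v

/-- The Lagrangian `L(q, v) = sup_p (⟪p, v⟫ - H(q, p))`. -/
noncomputable def lagrangian (H : E → E → ℝ) (q v : E) : ℝ := ⨆ p, (⟪p, v⟫ - H q p)

namespace IsTonelliHamiltonian

variable {H : E → E → ℝ} {m M : ℝ}

theorem inner_sub_le (hH : IsTonelliHamiltonian H m M) (q v p : E) :
    ⟪p, v⟫ - H q p ≤ ‖v‖ ^ 2 / (2 * m) + M := by
  have h1 := real_inner_le_norm p v
  have h2 := hH.lower q p
  have hm := hH.pos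
  have h3 : ‖p‖ * ‖v‖ ≤ m / 2 * ‖p‖ ^ 2 + ‖v‖ ^ 2 / (2 * m) := by
    have : m / 2 * ‖p‖ ^ 2 + ‖v‖ ^ 2 / (2 * m) - ‖p‖ * ‖v‖
      = (m * ‖p‖ - ‖v‖) ^ 2 / (2 * m) := by field_simp; ring
    have : 0 ≤ (m * ‖p‖ - ‖v‖) ^ 2 / (2 * m) := by positivity
    linarith
  linarith

theorem bddAbove (hH : IsTonelliHamiltonian H m M) (q v : E) :
    BddAbove (range fun p => ⟪p, v⟫ - H q p) :=
  ⟨_, forall_mem_range.2 (hH.inner_sub_le q v)⟩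

theorem inner_sub_le_lagrangian (hH : IsTonelliHamiltonian H m M) (q v p : E) :
    ⟪p, v⟫ - H q p ≤ lagrangian H q v :=
  le_ciSup (hH.bddAbove q v) p

theorem lagrangian_second_le (hH : IsTonelliHamiltonian H m M) (q h v k : E) :
    lagrangian H (q + h) (v + k) + lagrangian H (q - h) (v - k) - 2 * lagrangian H q v
      ≤ (2 * M ^ 2 / m + M) * ‖h‖ ^ 2 + 2 / m * ‖k‖ ^ 2 := by
  have hm := hH.pos
  have hM : 0 < M := hm.trans_le hH.le
  suffices hs : ∀ p₁ p₂, (⟪p₁, v + k⟫ - H (q + h) p₁) + (⟪p₂, v - k⟫ - H (q - h) p₂)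
      ≤ 2 * lagrangian H q v + ((2 * M ^ 2 / m + M) * ‖h‖ ^ 2 + 2 / m * ‖k‖ ^ 2) by
    have := ciSup_add_ciSup_le hs
    simp only [lagrangian] at this ⊢
    linarith
  intro p₁ p₂
  obtain ⟨p, δ, rfl, rfl⟩ : ∃ p δ, p₁ = p + δ ∧ p₂ = p - δ :=
    ⟨(1 / 2 : ℝ) • (p₁ + p₂), (1 / 2 : ℝ) • (p₁ - p₂), by module, by module⟩
  have h1 := hH.inner_sub_le_lagrangian q v p
  have h2 := hH.le_second q h p δ
  have h3 := real_inner_le_norm δ k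
  have h4 : 2 * (‖δ‖ * ‖k‖) - m * ‖δ‖ ^ 2 + 2 * M * ‖h‖ * ‖δ‖ + M * ‖h‖ ^ 2
      ≤ (2 * M ^ 2 / m + M) * ‖h‖ ^ 2 + 2 / m * ‖k‖ ^ 2 := by
    have e : (2 * M ^ 2 / m + M) * ‖h‖ ^ 2 + 2 / m * ‖k‖ ^ 2
      - (2 * (‖δ‖ * ‖k‖) - m * ‖δ‖ ^ 2 + 2 * M * ‖h‖ * ‖δ‖ + M * ‖h‖ ^ 2)
      = ((m * ‖δ‖ - (‖k‖ + M * ‖h‖)) ^ 2 + (‖k‖ - M * ‖h‖) ^ 2) / m := by field_simp; ring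
    have : 0 ≤ ((m * ‖δ‖ - (‖k‖ + M * ‖h‖)) ^ 2 + (‖k‖ - M * ‖h‖) ^ 2) / m := by positivity
    linarith
  simp only [inner_add_left, inner_add_right, inner_sub_left, inner_sub_right]
  linarith

theorem le_lagrangian_second (hH : IsTonelliHamiltonian H m M) (q h v k : E) :
    1 / M * ‖k‖ ^ 2 - M * ‖h‖ ^ 2
      ≤ lagrangian H (q + h) (v + k) + lagrangian H (q - h) (v - k) - 2 * lagrangian H q v := by
  have hM : 0 < M := hH.pos.trans_le hH.le
  suffices hs : lagrangian H q v ≤ (lagrangian H (q + h) (v + k) + lagrangian H (q - h) (v - k)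
      - (1 / M * ‖k‖ ^ 2 - M * ‖h‖ ^ 2)) / 2 by linarith
  refine ciSup_le fun p => ?_
  have h1 := hH.inner_sub_le_lagrangian (q + h) (v + k) (p + (1 / M) • k)
  have h2 := hH.inner_sub_le_lagrangian (q - h) (v - k) (p - (1 / M) • k)
  have h3 := hH.second_le q h p ((1 / M) • k)
  simp only [inner_add_left, inner_add_right, inner_sub_left, inner_sub_right,
    real_inner_smul_left, real_inner_self_eq_norm_sq] at h1 h2
  rw [norm_smul, Real.norm_of_nonneg (by positivity)] at h3
  have e : M * (‖h‖ ^ 2 + (1 / M * ‖k‖) ^ 2) = M * ‖h‖ ^ 2 + 1 / M * ‖k‖ ^ 2 := by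
    field_simp
  linarith

theorem abs_lagrangian_le (hH : IsTonelliHamiltonian H m M) (q v : E) :
    |lagrangian H q v| ≤ ‖v‖ ^ 2 / (2 * m) + M := by
  have hm := hH.pos
  refine abs_le.2 ⟨?_, ciSup_le (hH.inner_sub_le q v)⟩
  have h1 := hH.inner_sub_le_lagrangian q v 0
  have h2 := hH.upper q 0
  simp only [inner_zero_left, norm_zero] at h1 h2
  have : 0 ≤ ‖v‖ ^ 2 / (2 * m) := by positivity
  linarith

theorem exists_isTonelliLagrangian (hH : IsTonelliHamiltonian H m M) (a : ℝ) :
    ∃ c C, IsTonelliLagrangian (fun q v => lagrangian H q v + a) c C := by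
  have hm := hH.pos
  have hM : 0 < M := hm.trans_le hH.le
  set C := |a| + 1 / (2 * m) + 2 * M ^ 2 / m + M + 2 / m with hC
  have i1 : 0 ≤ 1 / (2 * m) := by positivity
  have i2 : 0 ≤ 2 * M ^ 2 / m := by positivity
  have i3 : 0 ≤ 2 / m := by positivity
  have i4 := abs_nonneg a
  have hC0 : 0 ≤ C := by positivity
  have bound : ∀ q v, |lagrangian H q v + a| ≤ C * (1 + ‖v‖ ^ 2) := by
    intro q v
    have h1 := abs_add_le (lagrangian H q v) a
    have h2 := hH.abs_lagrangian_le q v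
    have h3 : ‖v‖ ^ 2 / (2 * m) = 1 / (2 * m) * ‖v‖ ^ 2 := by ring
    have h4 : 1 / (2 * m) * ‖v‖ ^ 2 ≤ C * ‖v‖ ^ 2 := by
      gcongr
      linarith
    nlinarith
  have second_le : ∀ q h v k, (lagrangian H (q + h) (v + k) + a)
      + (lagrangian H (q - h) (v - k) + a) - 2 * (lagrangian H q v + a)
      ≤ C * (‖h‖ ^ 2 + ‖k‖ ^ 2) := by
    intro q h v k
    have h1 := hH.lagrangian_second_le q h v k
    have h2 : (2 * M ^ 2 / m + M) * ‖h‖ ^ 2 ≤ C * ‖h‖ ^ 2 := by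
      gcongr
      linarith
    have h3 : 2 / m * ‖k‖ ^ 2 ≤ C * ‖k‖ ^ 2 := by
      gcongr
      linarith
    linarith
  have le_second : ∀ q h v k, 1 / M * ‖k‖ ^ 2 - C * ‖h‖ ^ 2 ≤ (lagrangian H (q + h) (v + k) + a)
      + (lagrangian H (q - h) (v - k) + a) - 2 * (lagrangian H q v + a) := by
    intro q h v k
    have h1 := hH.le_lagrangian_second q h v k
    have h2 : M * ‖h‖ ^ 2 ≤ C * ‖h‖ ^ 2 := by
      gcongr
      linarith
    linarith
  refine ⟨1 / M, C, by positivity, hC0, ?_, bound, second_le, le_second⟩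
  refine continuous_of_second_difference (K := 2 * C) (fun x w => ?_) fun x =>
    ⟨1, one_pos, C * (1 + (‖x.2‖ + 1) ^ 2), fun h hh => (bound _ _).trans ?_⟩
  · have h1 := second_le x.1 w.1 x.2 w.2
    have h2 := le_second x.1 w.1 x.2 w.2
    have h3 : C * ‖w.1‖ ^ 2 ≤ C * ‖w‖ ^ 2 := by
      gcongr
      exact norm_fst_le w
    have h4 : C * ‖w.2‖ ^ 2 ≤ C * ‖w‖ ^ 2 := by
      gcongr
      exact norm_snd_le w
    have h5 : 0 ≤ 1 / M * ‖w.2‖ ^ 2 := by positivity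
    have h6 : 0 ≤ C * ‖w‖ ^ 2 := by positivity
    simp only [Prod.fst_add, Prod.snd_add, Prod.fst_sub, Prod.snd_sub]
    refine abs_le.2 ⟨?_, ?_⟩ <;> linarith
  · gcongr
    exact (norm_add_le _ _).trans (by gcongr; exact (norm_snd_le h).trans hh)

end IsTonelliHamiltonian

/-- Only one inequality of Legendre duality is needed: momenta dominated by the Lagrangian lie
in the sublevel of the Hamiltonian. -/
theorem le_of_forall_inner_le_lagrangian {H : E → E → ℝ} {q p : E} {a : ℝ}
    (hconv : ∃ w, ∀ p', H q p + ⟪p' - p, w⟫ ≤ H q p')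
    (h : ∀ w, ⟪p, w⟫ ≤ lagrangian H q w + a) : H q p ≤ a := by
  obtain ⟨w, hw⟩ := hconv
  have h1 : lagrangian H q w ≤ ⟪p, w⟫ - H q p := by
    refine ciSup_le fun p' => ?_
    have := hw p'
    rw [inner_sub_left] at this
    linarith
  linarith [h w]

section Smooth

variable {H : E → E → ℝ} {m M : ℝ}

theorem fderiv_fderiv_partial (hH : ContDiff ℝ 2 fun x : E × E => H x.1 x.2) (q p v : E) :
    fderiv ℝ (fderiv ℝ fun x : E × E => H x.1 x.2) (q, p) (0, v) (0, v)
      = iteratedFDeriv ℝ 2 (fun p' => H q p') p ![v, v] := by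
  rw [iteratedFDeriv_two_apply]
  have hlin : ∀ p', HasFDerivAt (fun p' : E => (q, p')) (ContinuousLinearMap.inr ℝ E E) p' :=
    fun p' => hasFDerivAt_prodMk_right q p'
  have hdf : ∀ y, HasFDerivAt (fun x : E × E => H x.1 x.2)
      (fderiv ℝ (fun x : E × E => H x.1 x.2) y) y := fun y =>
    (hH.differentiable (by norm_num) y).hasFDerivAt
  have hdf2 : ∀ y, HasFDerivAt (fderiv ℝ (fun x : E × E => H x.1 x.2))
      (fderiv ℝ (fderiv ℝ (fun x : E × E => H x.1 x.2)) y) y := fun y =>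
    ((hH.fderiv_right (m := 1) (by norm_num)).differentiable (by norm_num) y).hasFDerivAt
  have e1 : fderiv ℝ (fun p' => H q p') = fun p' =>
      (fderiv ℝ (fun x : E × E => H x.1 x.2) (q, p')).comp (ContinuousLinearMap.inr ℝ E E) :=
    funext fun p' => ((hdf (q, p')).comp p' (hlin p')).fderiv
  have e2 : HasFDerivAt (fun p' => fderiv ℝ (fun x : E × E => H x.1 x.2) (q, p')) _ p :=
    HasFDerivAt.comp (g := fderiv ℝ fun x : E × E => H x.1 x.2)
      (g' := fderiv ℝ (fderiv ℝ (fun x : E × E => H x.1 x.2)) (q, p)) p (hdf2 (q, p)) (hlin p)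
  rw [e1, (e2.clm_comp (hasFDerivAt_const (ContinuousLinearMap.inr ℝ E E) p)).fderiv]
  simp

theorem isTonelliHamiltonian_of_contDiff (hH : ContDiff ℝ 2 fun x : E × E => H x.1 x.2)
    (hm : 0 < m) (hmM : m ≤ M)
    (hd2H : ∀ x, ‖iteratedFDeriv ℝ 2 (fun y : E × E => H y.1 y.2) x‖ ≤ M)
    (hconv : ∀ q p v, m * ‖v‖ ^ 2 ≤ iteratedFDeriv ℝ 2 (fun p' => H q p') p ![v, v])
    (hlower : ∀ q p, m / 2 * ‖p‖ ^ 2 - M ≤ H q p)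
    (hupper : ∀ q p, H q p ≤ M / 2 * ‖p‖ ^ 2 + M) : IsTonelliHamiltonian H m M := by
  have hM : 0 < M := hm.trans_le hmM
  set F : E × E → ℝ := fun x => H x.1 x.2 with hF
  have bil : ∀ y v w, |fderiv ℝ (fderiv ℝ F) y v w| ≤ M * ‖v‖ * ‖w‖ := by
    intro y v w
    have h1 := (iteratedFDeriv ℝ 2 F y).le_opNorm ![v, w]
    rw [iteratedFDeriv_two_apply] at h1
    simp only [Fin.prod_univ_two, Matrix.cons_val_zero, Matrix.cons_val_one,
      Real.norm_eq_abs] at h1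
    refine h1.trans ?_
    rw [mul_assoc]
    gcongr
    exact hd2H y
  refine ⟨hm, hmM, hlower, hupper, fun q h p k => ?_, fun q h p k => ?_⟩
  · have hc : ∀ y, -(M * (‖h‖ ^ 2 + ‖k‖ ^ 2))
        ≤ fderiv ℝ (fderiv ℝ fun x => -F x) y (h, k) (h, k) := by
      intro y
      have e1 : (fderiv ℝ fun x => -F x) = fun x => -fderiv ℝ F x :=
        funext fun x => fderiv_fun_neg
      have e2 : fderiv ℝ (fun x => -fderiv ℝ F x) y = -fderiv ℝ (fderiv ℝ F) y :=
        (((hH.fderiv_right (m := 1) (by norm_num)).differentiable (by norm_num)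
          y).hasFDerivAt.neg).fderiv
      rw [e1, e2]
      have h1 := (abs_le.1 (bil y (h, k) (h, k))).2
      have h2 : ‖(h, k)‖ * ‖(h, k)‖ ≤ ‖h‖ ^ 2 + ‖k‖ ^ 2 := by
        rw [Prod.norm_def]
        rcases max_cases ‖h‖ ‖k‖ with ⟨e, _⟩ | ⟨e, _⟩ <;> simp only [e] <;>
            nlinarith [sq_nonneg ‖h‖, sq_nonneg ‖k‖]
      have h3 := mul_le_mul_of_nonneg_left h2 hM.le
      simp only [neg_apply]
      linarith
    have := second_difference_lower_bound (z := (q, p)) hH.neg hc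
    simp only [hF, Prod.mk_add_mk, Prod.mk_sub_mk] at this
    linarith
  · refine second_difference_lower_bound (f := F) (z := (q, p)) (w := (h, k)) hH fun y => ?_
    have h0 := hconv y.1 y.2 k
    rw [← fderiv_fderiv_partial hH] at h0
    have h1 := (abs_le.1 (bil y (h, 0) (h, 0))).1
    have h2 := (abs_le.1 (bil y (h, 0) (0, k))).1
    have h3 := (abs_le.1 (bil y (0, k) (h, 0))).1
    have e : ((h, k) : E × E) = (h, 0) + (0, k) := by simp
    have n1 : ‖((h, 0) : E × E)‖ = ‖h‖ := by simp [Prod.norm_def]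
    have n2 : ‖((0, k) : E × E)‖ = ‖k‖ := by simp [Prod.norm_def]
    rw [n1] at h1
    rw [n1, n2] at h2 h3
    rw [e]
    simp only [map_add, add_apply]
    linarith

theorem exists_subgradient_of_contDiff [CompleteSpace E]
    (hH : ContDiff ℝ 2 fun x : E × E => H x.1 x.2)
    (hm : 0 ≤ m)
    (hconv : ∀ q p v, m * ‖v‖ ^ 2 ≤ iteratedFDeriv ℝ 2 (fun p' => H q p') p ![v, v]) (q p : E) :
    ∃ w, ∀ p', H q p + ⟪p' - p, w⟫ ≤ H q p' := by
  have hHq : ContDiff ℝ 2 (H q) := hH.comp (contDiff_prodMk_right q)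
  refine ⟨gradient (H q) p, fun p' => ?_⟩
  have := taylor_lower_bound hHq (z := p) (w := p' - p) (c := 0) fun y => by
    have h := hconv q y (p' - p)
    rw [iteratedFDeriv_two_apply] at h
    exact le_trans (by positivity) h
  rw [add_sub_cancel] at this
  rw [real_inner_comm, gradient, InnerProductSpace.toDual_symm_apply]
  linarith

end Smooth

end Lagrangian

section Control

set_option linter.unusedSectionVars false

variable {E : Type*} [NormedAddCommGroup E] [InnerProductSpace ℝ E] [FiniteDimensional ℝ E]
  [MeasurableSpace E] [BorelSpace E]

/-- Bounded measurable velocity fields along the time line. -/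
def IsControl (v : ℝ → E) : Prop := Measurable v ∧ ∃ R, ∀ s, ‖v s‖ ≤ R

/-- The curve issued from `q` with velocity `v`. -/
noncomputable def controlCurve (q : E) (v : ℝ → E) (s : ℝ) : E := q + ∫ r in (0 : ℝ)..s, v r

/-- The action of the curve issued from `q` with velocity `v`, over the time interval `[0, t]`. -/
noncomputable def action (L : E → E → ℝ) (q : E) (v : ℝ → E) (t : ℝ) : ℝ :=
  ∫ s in (0 : ℝ)..t, L (controlCurve q v s) (v s)

namespace IsControl

variable {v w : ℝ → E}

theorem const (x : E) : IsControl fun _ => x := ⟨measurable_const, ‖x‖, fun _ => le_rfl⟩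

theorem add (hv : IsControl v) (hw : IsControl w) : IsControl fun s => v s + w s := by
  obtain ⟨hv, R, hR⟩ := hv
  obtain ⟨hw, R', hR'⟩ := hw
  exact ⟨hv.add hw, R + R', fun s => (norm_add_le _ _).trans (add_le_add (hR s) (hR' s))⟩

theorem smul (c : ℝ) (hv : IsControl v) : IsControl fun s => c • v s := by
  obtain ⟨hv, R, hR⟩ := hv
  refine ⟨hv.const_smul c, |c| * R, fun s => ?_⟩
  rw [norm_smul, Real.norm_eq_abs]
  exact mul_le_mul_of_nonneg_left (hR s) (abs_nonneg c)

theorem neg (hv : IsControl v) : IsControl fun s => -v s := by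
  simpa using hv.smul (-1)

theorem sub (hv : IsControl v) (hw : IsControl w) : IsControl fun s => v s - w s := by
  simpa [sub_eq_add_neg] using hv.add hw.neg

theorem comp (hv : IsControl v) {φ : ℝ → ℝ} (hφ : Measurable φ) : IsControl fun s => v (φ s) :=
  ⟨hv.1.comp hφ, hv.2.imp fun _ h s => h (φ s)⟩

theorem concat (hv : IsControl v) (hw : IsControl w) (t : ℝ) :
    IsControl fun s => if s ≤ t then v s else w (s - t) := by
  refine ⟨Measurable.ite measurableSet_Iic hv.1 (hw.1.comp (measurable_id.sub_const t)), ?_⟩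
  obtain ⟨-, R, hR⟩ := hv
  obtain ⟨-, R', hR'⟩ := hw
  refine ⟨max R R', fun s => ?_⟩
  dsimp only
  split_ifs
  · exact (hR s).trans (le_max_left _ _)
  · exact (hR' _).trans (le_max_right _ _)

theorem intervalIntegrable (hv : IsControl v) (a b : ℝ) : IntervalIntegrable v volume a b := by
  obtain ⟨hv, R, hR⟩ := hv
  exact (intervalIntegrable_const (c := R)).mono_fun' hv.aestronglyMeasurable
    (Eventually.of_forall hR)

theorem lipschitz_controlCurve (hv : IsControl v) (q : E) :
    ∃ K : ℝ≥0, LipschitzWith K (controlCurve q v) := by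
  obtain ⟨R, hR⟩ := hv.2
  refine ⟨R.toNNReal, LipschitzWith.of_dist_le_mul fun s t => ?_⟩
  have e : controlCurve q v s - controlCurve q v t = ∫ r in t..s, v r := by
    simp only [controlCurve]
    rw [← intervalIntegral.integral_add_adjacent_intervals (hv.intervalIntegrable 0 t)
      (hv.intervalIntegrable t s)]
    abel
  rw [dist_eq_norm, e, Real.dist_eq, Real.coe_toNNReal R ((norm_nonneg _).trans (hR 0))]
  exact intervalIntegral.norm_integral_le_of_norm_le_const fun r _ => hR r

theorem continuous_controlCurve (hv : IsControl v) (q : E) : Continuous (controlCurve q v) :=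
  (hv.lipschitz_controlCurve q).choose_spec.continuous

theorem controlCurve_add (hv : IsControl v) (q : E) (r s : ℝ) :
    controlCurve q v (r + s) = controlCurve (controlCurve q v r) (fun τ => v (r + τ)) s := by
  simp only [controlCurve]
  rw [intervalIntegral.integral_comp_add_left v, add_zero, add_assoc,
    intervalIntegral.integral_add_adjacent_intervals (hv.intervalIntegrable _ _)
      (hv.intervalIntegrable _ _)]

variable {L : E → E → ℝ} {c C : ℝ}

theorem measurable_action (hL : IsTonelliLagrangian L c C) {γ : ℝ → E} (hγ : Measurable γ)
    (hv : IsControl v) : Measurable fun s => L (γ s) (v s) :=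
  hL.continuous.measurable.comp (hγ.prodMk hv.1)

theorem exists_bound (hL : IsTonelliLagrangian L c C) (hv : IsControl v) :
    ∃ B, ∀ q s, ‖L q (v s)‖ ≤ B := by
  obtain ⟨R, hR⟩ := hv.2
  refine ⟨C * (1 + R ^ 2), fun q s => (hL.bound _ _).trans ?_⟩
  have := hL.nonneg
  gcongr
  exact hR s

theorem intervalIntegrable_lagrangian (hL : IsTonelliLagrangian L c C) (hv : IsControl v)
    {γ : ℝ → E} (hγ : Measurable γ) (a b : ℝ) :
    IntervalIntegrable (fun s => L (γ s) (v s)) volume a b := by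
  obtain ⟨B, hB⟩ := hv.exists_bound hL
  exact (intervalIntegrable_const (c := B)).mono_fun'
    (measurable_action hL hγ hv).aestronglyMeasurable
    (Eventually.of_forall fun s => hB _ s)

theorem intervalIntegrable_action (hL : IsTonelliLagrangian L c C) (hv : IsControl v) (q : E)
    (a b : ℝ) : IntervalIntegrable (fun s => L (controlCurve q v s) (v s)) volume a b :=
  hv.intervalIntegrable_lagrangian hL (hv.continuous_controlCurve q).measurable a b

theorem action_add (hL : IsTonelliLagrangian L c C) (hv : IsControl v) (q : E) (r s : ℝ) :
    action L q v (r + s)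
      = action L q v r + action L (controlCurve q v r) (fun τ => v (r + τ)) s := by
  simp only [action]
  simp_rw [← hv.controlCurve_add]
  rw [intervalIntegral.integral_comp_add_left (fun τ => L (controlCurve q v τ) (v τ)), add_zero,
    intervalIntegral.integral_add_adjacent_intervals (hv.intervalIntegrable_action hL _ _ _)
      (hv.intervalIntegrable_action hL _ _ _)]

end IsControl

theorem controlCurve_congr {q : E} {v w : ℝ → E} {t : ℝ} (ht : 0 ≤ t)
    (h : ∀ s ∈ Ioo 0 t, v s = w s) : controlCurve q v t = controlCurve q w t := by
  simp only [controlCurve]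
  rw [intervalIntegral.integral_congr_Ioo_of_le ht h]

theorem action_congr {L : E → E → ℝ} {q : E} {v w : ℝ → E} {t : ℝ} (ht : 0 ≤ t)
    (h : ∀ s ∈ Ioo 0 t, v s = w s) : action L q v t = action L q w t := by
  refine intervalIntegral.integral_congr_Ioo_of_le ht fun s hs => ?_
  rw [h s hs, controlCurve_congr hs.1.le fun r hr => h r ⟨hr.1, hr.2.trans hs.2⟩]

/-- `u(γ(0)) ≤ u(γ(t)) + ∫ L(γ, γ')` along every curve. -/
def IsDominated (L : E → E → ℝ) (u : E → ℝ) : Prop :=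
  ∀ q v, IsControl v → ∀ t, 0 ≤ t → u q ≤ u (controlCurve q v t) + action L q v t

theorem IsDominated.reverse {L : E → E → ℝ} {u : E → ℝ} (hu : IsDominated L u) :
    IsDominated (fun q v => L q (-v)) (fun q => -u q) := by
  intro q v hv t ht
  have hw : IsControl fun s => -v (t - s) := (hv.comp (measurable_const.sub measurable_id)).neg
  have hcurve : ∀ s, controlCurve (controlCurve q v t) (fun s => -v (t - s)) s
      = controlCurve q v (t - s) := by
    intro s
    simp only [controlCurve, intervalIntegral.integral_neg]
    rw [intervalIntegral.integral_comp_sub_left v, sub_zero,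
      ← intervalIntegral.integral_add_adjacent_intervals (hv.intervalIntegrable 0 (t - s))
        (hv.intervalIntegrable (t - s) t)]
    abel
  have h := hu (controlCurve q v t) _ hw t ht
  have hact : action L (controlCurve q v t) (fun s => -v (t - s)) t
      = action (fun q v => L q (-v)) q v t := by
    simp only [action, hcurve]
    rw [intervalIntegral.integral_comp_sub_left fun s => L (controlCurve q v s) (-v s)]
    simp
  have h0 : controlCurve q v 0 = q := by simp [controlCurve]
  rw [hact, hcurve, sub_self, h0] at h
  linarith

theorem IsTonelliLagrangian.reverse {L : E → E → ℝ} {c C : ℝ} (hL : IsTonelliLagrangian L c C) :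
    IsTonelliLagrangian (fun q v => L q (-v)) c C := by
  refine ⟨hL.pos, hL.nonneg, hL.continuous.comp (continuous_fst.prodMk continuous_snd.neg),
    fun q v => ?_, fun q h v k => ?_, fun q h v k => ?_⟩
  · simpa using hL.bound q (-v)
  · simpa [add_comm, sub_eq_add_neg] using hL.second_le q h (-v) (-k)
  · simpa [add_comm, sub_eq_add_neg] using hL.le_second q h (-v) (-k)

/-- The Lax–Oleinik semi-group, as an infimum over curves issued from a point. -/
noncomputable def laxOleinik (L : E → E → ℝ) (t : ℝ) (u : E → ℝ) (q : E) : ℝ :=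
  ⨅ v : {v : ℝ → E // IsControl v}, (u (controlCurve q v t) + action L q v t)

instance : Nonempty {v : ℝ → E // IsControl v} := ⟨⟨_, IsControl.const 0⟩⟩

namespace IsDominated

variable {L : E → E → ℝ} {c C : ℝ} {u : E → ℝ} {t : ℝ}

theorem le_laxOleinik (hu : IsDominated L u) (ht : 0 ≤ t) (q : E) : u q ≤ laxOleinik L t u q :=
  le_ciInf fun v => hu q v v.2 t ht

theorem laxOleinik_le (hu : IsDominated L u) (ht : 0 ≤ t) (q : E) {v : ℝ → E} (hv : IsControl v) :
    laxOleinik L t u q ≤ u (controlCurve q v t) + action L q v t :=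
  ciInf_le (f := fun v : {v : ℝ → E // IsControl v} => u (controlCurve q v t) + action L q v t)
    ⟨u q, forall_mem_range.2 fun v => hu q v v.2 t ht⟩ ⟨v, hv⟩

theorem laxOleinik_le_add (hL : IsTonelliLagrangian L c C) (hu : IsDominated L u) (ht : 0 ≤ t)
    (q : E) : laxOleinik L t u q ≤ u q + t * C := by
  refine (hu.laxOleinik_le ht q (IsControl.const 0)).trans ?_
  have h := (abs_le.1 (hL.bound q 0)).2
  simp only [norm_zero] at h
  have : t * L q 0 ≤ t * C := by
    gcongr
    linarith
  simpa [controlCurve, action] using this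

theorem isDominated_laxOleinik (hL : IsTonelliLagrangian L c C) (hu : IsDominated L u) (ht : 0 ≤ t) :
    IsDominated L (laxOleinik L t u) := by
  intro q v hv s hs
  rw [← sub_le_iff_le_add]
  refine le_ciInf fun ⟨w, hw⟩ => ?_
  simp only
  set z : ℝ → E := fun r => if r ≤ s then v r else w (r - s) with hz
  have hzc : IsControl z := hv.concat hw s
  have z1 : ∀ r ∈ Ioo 0 s, z r = v r := fun r hr => if_pos hr.2.le
  have z2 : ∀ r ∈ Ioo 0 t, (fun r => z (s + r)) r = w r := fun r hr => by
    have : ¬ s + r ≤ s := by linarith [hr.1]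
    simp [hz, hr.1]
  have e1 := hzc.action_add hL q s t
  have e2 := hzc.action_add hL q t s
  have c1 := hzc.controlCurve_add q s t
  have c2 := hzc.controlCurve_add q t s
  rw [controlCurve_congr ht z2, controlCurve_congr hs z1] at c1
  rw [action_congr ht z2, controlCurve_congr hs z1, action_congr hs z1] at e1
  have h1 := hu.laxOleinik_le ht q hzc
  have h2 := hu (controlCurve q z t) _ (hzc.comp (measurable_const_add t)) s hs
  rw [← c2, add_comm t s, c1] at h2
  rw [add_comm t s] at e2
  linarith

end IsDominated

namespace IsControl

variable {L : E → E → ℝ} {c C : ℝ} {v k : ℝ → E}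

theorem controlCurve_add_add (hv : IsControl v) (hk : IsControl k) (q h : E) (s : ℝ) :
    controlCurve (q + h) (fun s => v s + k s) s = controlCurve q v s + controlCurve h k s := by
  simp only [controlCurve]
  rw [intervalIntegral.integral_add (hv.intervalIntegrable _ _) (hk.intervalIntegrable _ _)]
  abel

theorem controlCurve_sub_sub (hv : IsControl v) (hk : IsControl k) (q h : E) (s : ℝ) :
    controlCurve (q - h) (fun s => v s - k s) s = controlCurve q v s - controlCurve h k s := by
  simp only [controlCurve]
  rw [intervalIntegral.integral_sub (hv.intervalIntegrable _ _) (hk.intervalIntegrable _ _)]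
  abel

theorem action_second_difference (hL : IsTonelliLagrangian L c C) (hv : IsControl v)
    (hk : IsControl k) (q h : E) (t : ℝ) :
    action L (q + h) (fun s => v s + k s) t + action L (q - h) (fun s => v s - k s) t
        - 2 * action L q v t
      = ∫ s in (0 : ℝ)..t, (L (controlCurve q v s + controlCurve h k s) (v s + k s)
        + L (controlCurve q v s - controlCurve h k s) (v s - k s)
        - 2 * L (controlCurve q v s) (v s)) := by
  have i1 := (hv.add hk).intervalIntegrable_action hL (q + h) 0 t
  have i2 := (hv.sub hk).intervalIntegrable_action hL (q - h) 0 t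
  have i3 := hv.intervalIntegrable_action hL q 0 t
  simp only [controlCurve_add_add hv hk, controlCurve_sub_sub hv hk] at i1 i2
  simp only [action, controlCurve_add_add hv hk, controlCurve_sub_sub hv hk]
  rw [intervalIntegral.integral_sub (i1.add i2) (i3.const_mul 2),
    intervalIntegral.integral_add i1 i2, intervalIntegral.integral_const_mul]

theorem intervalIntegrable_second_difference (hL : IsTonelliLagrangian L c C) (hv : IsControl v)
    (hk : IsControl k) (q h : E) (t : ℝ) :
    IntervalIntegrable (fun s => L (controlCurve q v s + controlCurve h k s) (v s + k s)
        + L (controlCurve q v s - controlCurve h k s) (v s - k s)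
        - 2 * L (controlCurve q v s) (v s)) volume 0 t := by
  have i1 := (hv.add hk).intervalIntegrable_action hL (q + h) 0 t
  have i2 := (hv.sub hk).intervalIntegrable_action hL (q - h) 0 t
  have i3 := hv.intervalIntegrable_action hL q 0 t
  simp only [controlCurve_add_add hv hk, controlCurve_sub_sub hv hk] at i1 i2
  exact (i1.add i2).sub (i3.const_mul 2)

theorem intervalIntegrable_norm_sq (hk : IsControl k) (a b : ℝ) :
    IntervalIntegrable (fun s => ‖k s‖ ^ 2) volume a b := by
  obtain ⟨hk, R, hR⟩ := hk
  refine (intervalIntegrable_const (c := R ^ 2)).mono_fun'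
    (hk.norm.pow_const 2).aestronglyMeasurable (Eventually.of_forall fun s => ?_)
  dsimp only
  rw [Real.norm_of_nonneg (by positivity)]
  have := hR s
  gcongr

theorem norm_sq_integral_le (hk : IsControl k) {s t : ℝ} (hs : 0 ≤ s) (hst : s ≤ t) :
    ‖∫ r in (0 : ℝ)..s, k r‖ ^ 2 ≤ t * ∫ r in (0 : ℝ)..t, ‖k r‖ ^ 2 := by
  rcases (hs.trans hst).eq_or_lt with rfl | ht
  · obtain rfl : s = 0 := le_antisymm hst hs
    simp
  have hi := (hk.intervalIntegrable 0 t).norm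
  have h1 : ‖∫ r in (0 : ℝ)..s, k r‖ ≤ ∫ r in (0 : ℝ)..t, ‖k r‖ :=
    (intervalIntegral.norm_integral_le_integral_norm hs).trans
      (intervalIntegral.integral_mono_interval le_rfl hs hst
        (Eventually.of_forall fun r => norm_nonneg _) hi)
  set J := ∫ r in (0 : ℝ)..t, ‖k r‖ with hJ
  have h2 : 0 ≤ ∫ r in (0 : ℝ)..t, (‖k r‖ ^ 2 - 2 * (J / t) * ‖k r‖ + (J / t) ^ 2) := by
    refine intervalIntegral.integral_nonneg ht.le fun r _ => ?_
    nlinarith [sq_nonneg (‖k r‖ - J / t)]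
  rw [intervalIntegral.integral_add ((hk.intervalIntegrable_norm_sq 0 t).sub (hi.const_mul _))
    intervalIntegrable_const, intervalIntegral.integral_sub (hk.intervalIntegrable_norm_sq 0 t)
    (hi.const_mul _), intervalIntegral.integral_const_mul, intervalIntegral.integral_const,
    ← hJ, smul_eq_mul, sub_zero] at h2
  set I := ∫ r in (0 : ℝ)..t, ‖k r‖ ^ 2
  have h3 : I - 2 * (J / t) * J + t * (J / t) ^ 2 = (t * I - J ^ 2) / t := by field_simp; ring
  rw [h3, le_div_iff₀ ht, zero_mul] at h2
  have : ‖∫ r in (0 : ℝ)..s, k r‖ ^ 2 ≤ J ^ 2 := by gcongr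
  linarith

theorem norm_sq_controlCurve_le (hk : IsControl k) (h : E) {s t : ℝ} (hs : 0 ≤ s) (hst : s ≤ t) :
    ‖controlCurve h k s‖ ^ 2 ≤ 2 * ‖h‖ ^ 2 + 2 * (t * ∫ r in (0 : ℝ)..t, ‖k r‖ ^ 2) := by
  have h1 := hk.norm_sq_integral_le hs hst
  have h2 : ‖controlCurve h k s‖ ^ 2 ≤ (‖h‖ + ‖∫ r in (0 : ℝ)..s, k r‖) ^ 2 := by
    gcongr
    exact norm_add_le _ _
  nlinarith [sq_nonneg (‖h‖ - ‖∫ r in (0 : ℝ)..s, k r‖)]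

end IsControl

namespace IsDominated

variable {L : E → E → ℝ} {c C : ℝ} {u : E → ℝ} {t : ℝ}

/-- The Lax–Oleinik semi-group is regularizing: its values are semi-concave. -/
theorem laxOleinik_second_le (hL : IsTonelliLagrangian L c C) (hu : IsDominated L u) (ht : 0 < t)
    (q h : E) : _root_.laxOleinik L t u (q + h) + _root_.laxOleinik L t u (q - h)
      - 2 * _root_.laxOleinik L t u q ≤ C * (t + 1 / t) * ‖h‖ ^ 2 := by
  suffices hs : (_root_.laxOleinik L t u (q + h) + _root_.laxOleinik L t u (q - h)
      - C * (t + 1 / t) * ‖h‖ ^ 2) / 2 ≤ _root_.laxOleinik L t u q by linarith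
  refine le_ciInf fun ⟨v, hv⟩ => ?_
  dsimp only
  set k : ℝ → E := fun _ => (-(1 / t)) • h with hk
  have hkc : IsControl k := IsControl.const _
  have hη : ∀ s, controlCurve h k s = (1 - s / t) • h := by
    intro s
    simp only [controlCurve, hk, intervalIntegral.integral_const, sub_zero]
    rw [smul_smul, sub_smul, one_smul, mul_neg, neg_smul, mul_one_div, ← sub_eq_add_neg]
  have hηt : controlCurve h k t = 0 := by rw [hη, div_self ht.ne', sub_self, zero_smul]
  have h1 := hu.laxOleinik_le ht.le (q + h) (hv.add hkc)
  have h2 := hu.laxOleinik_le ht.le (q - h) (hv.sub hkc)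
  rw [hv.controlCurve_add_add hkc, hηt, add_zero] at h1
  rw [hv.controlCurve_sub_sub hkc, hηt, sub_zero] at h2
  have h3 := hv.action_second_difference hL hkc q h t
  have h4 := intervalIntegral.integral_mono_on ht.le
    (hv.intervalIntegrable_second_difference hL hkc q h t)
    (intervalIntegrable_const (c := C * (‖h‖ ^ 2 + (1 / t * ‖h‖) ^ 2))) fun s hs => by
      refine (hL.second_le _ _ _ _).trans ?_
      have := hL.nonneg
      have n1 : ‖controlCurve h k s‖ ≤ ‖h‖ := by
        rw [hη, norm_smul]
        refine mul_le_of_le_one_left (norm_nonneg _) ?_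
        have a1 : 0 ≤ s / t := div_nonneg hs.1 ht.le
        have a2 : s / t ≤ 1 := div_le_one_of_le₀ hs.2 ht.le
        rw [Real.norm_eq_abs]
        exact abs_le.2 ⟨by linarith, by linarith⟩
      have n2 : ‖k s‖ = 1 / t * ‖h‖ := by
        rw [hk, norm_smul, norm_neg, Real.norm_of_nonneg (by positivity)]
      rw [n2]
      gcongr
  rw [intervalIntegral.integral_const, smul_eq_mul, sub_zero] at h4
  have h5 : t * (C * (‖h‖ ^ 2 + (1 / t * ‖h‖) ^ 2)) = C * (t + 1 / t) * ‖h‖ ^ 2 := by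
    field_simp
  linarith

/-- For small times, the Lax–Oleinik semi-group preserves semi-convexity. -/
theorem le_laxOleinik_second (hL : IsTonelliLagrangian L c C) (hu : IsDominated L u) (ht : 0 ≤ t)
    {A : ℝ} (hA : 0 ≤ A) (huA : ∀ q h, -(A * ‖h‖ ^ 2) ≤ u (q + h) + u (q - h) - 2 * u q)
    (htA : 2 * A * t + 2 * C * t ^ 2 ≤ c) (q h : E) :
    -((2 * A + 2 * C * t) * ‖h‖ ^ 2) ≤ _root_.laxOleinik L t u (q + h)
      + _root_.laxOleinik L t u (q - h) - 2 * _root_.laxOleinik L t u q := by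
  suffices hs : 2 * _root_.laxOleinik L t u q - (2 * A + 2 * C * t) * ‖h‖ ^ 2
      ≤ _root_.laxOleinik L t u (q + h) + _root_.laxOleinik L t u (q - h) by linarith
  refine le_ciInf_add_ciInf fun ⟨v₁, hv₁⟩ ⟨v₂, hv₂⟩ => ?_
  dsimp only
  obtain ⟨v, k, hv, hk, rfl, rfl⟩ : ∃ v k, IsControl v ∧ IsControl k ∧
      v₁ = (fun s => v s + k s) ∧ v₂ = fun s => v s - k s :=
    ⟨fun s => (1 / 2 : ℝ) • (v₁ s + v₂ s), fun s => (1 / 2 : ℝ) • (v₁ s - v₂ s),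
      (hv₁.add hv₂).smul _, (hv₁.sub hv₂).smul _, by funext s; module, by funext s; module⟩
  have h1 := hu.laxOleinik_le ht q hv
  have h2 := huA (controlCurve q v t) (controlCurve h k t)
  have h3 := hv.action_second_difference hL hk q h t
  have h4 := hk.norm_sq_controlCurve_le h ht le_rfl
  set I := ∫ r in (0 : ℝ)..t, ‖k r‖ ^ 2 with hI
  have h5 := intervalIntegral.integral_mono_on ht
    (((hk.intervalIntegrable_norm_sq 0 t).const_mul c).sub
      (intervalIntegrable_const (c := C * (2 * ‖h‖ ^ 2 + 2 * (t * I)))))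
    (hv.intervalIntegrable_second_difference hL hk q h t) fun s hs => by
      refine le_trans ?_ (hL.le_second _ _ _ _)
      have := mul_le_mul_of_nonneg_left (hk.norm_sq_controlCurve_le h hs.1 hs.2) hL.nonneg
      linarith
  rw [intervalIntegral.integral_sub ((hk.intervalIntegrable_norm_sq 0 t).const_mul c)
    intervalIntegrable_const, intervalIntegral.integral_const_mul,
    intervalIntegral.integral_const, smul_eq_mul, sub_zero, ← hI] at h5
  have hI0 : 0 ≤ I := intervalIntegral.integral_nonneg ht fun r _ => by positivity
  have h6 := mul_le_mul_of_nonneg_left h4 hA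
  have h7 := mul_le_mul_of_nonneg_right htA hI0
  rw [hv.controlCurve_add_add hk, hv.controlCurve_sub_sub hk]
  linarith

theorem apply_add_nonneg (hL : IsTonelliLagrangian L c C) (hu : IsDominated L u) {q : E}
    {p : E →L[ℝ] ℝ} (hp : HasFDerivAt u p q) (w : E) : 0 ≤ p w + L q w := by
  have hcurve : ∀ s, controlCurve q (fun _ => w) s = q + s • w := fun s => by
    simp [controlCurve]
  have hline : HasDerivAt (fun s : ℝ => q + s • w) w 0 := by
    simpa using ((hasDerivAt_id (0 : ℝ)).smul_const w).const_add q
  have d1 : HasDerivAt (fun s : ℝ => u (q + s • w)) (p w) 0 :=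
    HasFDerivAt.comp_hasDerivAt (l := u) (l' := p) 0 (by simpa using hp) hline
  have hcont : Continuous fun s : ℝ => L (q + s • w) w :=
    hL.continuous.comp ((by fun_prop : Continuous fun s : ℝ => q + s • w).prodMk continuous_const)
  have d2 : HasDerivAt (fun t : ℝ => ∫ s in (0 : ℝ)..t, L (q + s • w) w) (L q w) 0 := by
    simpa using (hcont.integral_hasStrictDerivAt 0 0).hasDerivAt
  have h := (d1.add d2).tendsto_slope_zero_right
  refine ge_of_tendsto h (eventually_mem_nhdsWithin.mono fun t ht => ?_)
  have ht : (0 : ℝ) < t := ht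
  have := hu q _ (IsControl.const w) t ht.le
  simp only [action, hcurve] at this
  simp only [smul_eq_mul, zero_add, Pi.add_apply, zero_smul, add_zero,
    intervalIntegral.integral_same]
  have := inv_pos.2 ht
  refine mul_nonneg this.le ?_
  linarith

end IsDominated

/-- Almost everywhere sub-solutions are dominated along curves. -/
theorem isDominated_neg_of_subsolution {L : E → E → ℝ} {c C : ℝ} {u : E → ℝ} {K : ℝ≥0}
    (hL : IsTonelliLagrangian L c C) (hu : LipschitzWith K u)
    (hsub : ∀ q, DifferentiableAt ℝ u q → ∀ w, fderiv ℝ u q w ≤ L q w) :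
    IsDominated L fun q => -u q := by
  intro q v hv t ht
  suffices hz : ∀ z : E, u (controlCurve q v t + z) - u (q + z)
      ≤ ∫ s in (0 : ℝ)..t, L (controlCurve q v s + z) (v s) by
    have := hz 0
    simp only [add_zero] at this
    simp only [action]
    linarith
  let μ : Measure E := Measure.addHaar
  have hγ : Continuous (controlCurve q v) := hv.continuous_controlCurve q
  have hmeas : MeasurableSet {x : ℝ × E | DifferentiableAt ℝ u (controlCurve q v x.1 + x.2)} :=
    (measurableSet_of_differentiableAt ℝ u).preimage
      (((hγ.comp continuous_fst).add continuous_snd).measurable)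
  have hae : ∀ᵐ z ∂μ, ∀ᵐ s : ℝ, DifferentiableAt ℝ u (controlCurve q v s + z) := by
    rw [← Measure.ae_ae_comm (μ := (volume : Measure ℝ)) (ν := μ) hmeas]
    exact Eventually.of_forall fun s =>
      (measurePreserving_add_left μ (controlCurve q v s)).quasiMeasurePreserving.ae
        hu.ae_differentiableAt
  have hloc : LocallyIntegrable v volume := by
    obtain ⟨hvm, R, hR⟩ := hv
    exact (locallyIntegrable_const R).mono hvm.aestronglyMeasurable
      (Eventually.of_forall fun s => (hR s).trans (le_abs_self R))
  have hgood : ∀ᵐ z ∂μ, u (controlCurve q v t + z) - u (q + z)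
      ≤ ∫ s in (0 : ℝ)..t, L (controlCurve q v s + z) (v s) := by
    filter_upwards [hae] with z hz
    obtain ⟨R, hR⟩ := hv.lipschitz_controlCurve q
    have hg : LipschitzWith (K * (R + 0)) fun s => u (controlCurve q v s + z) :=
      hu.comp (hR.add (LipschitzWith.const z))
    have hac := hg.lipschitzOnWith (s := uIcc 0 t) |>.absolutelyContinuousOnInterval
    have e := hac.integral_deriv_eq_sub
    have h0 : controlCurve q v 0 = q := by simp [controlCurve]
    rw [h0] at e
    rw [← e]
    refine intervalIntegral.integral_mono_ae ht hac.intervalIntegrable_deriv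
      (hv.intervalIntegrable_lagrangian hL (hγ.add continuous_const).measurable 0 t) ?_
    filter_upwards [hz, LocallyIntegrable.ae_hasDerivAt_integral hloc] with s hs hs'
    have hd : HasDerivAt (fun s => controlCurve q v s + z) (v s) s :=
      ((hs' 0).const_add q).add_const z
    have hd' : HasDerivAt (fun s => u (controlCurve q v s + z))
        (fderiv ℝ u (controlCurve q v s + z) (v s)) s :=
      HasFDerivAt.comp_hasDerivAt (l := u) s hs.hasFDerivAt hd
    rw [hd'.deriv]
    exact hsub _ hs _
  have hclosed : IsClosed {z | u (controlCurve q v t + z) - u (q + z)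
      ≤ ∫ s in (0 : ℝ)..t, L (controlCurve q v s + z) (v s)} := by
    refine isClosed_le ?_ ?_
    · exact (hu.continuous.comp (continuous_const.add continuous_id)).sub
        (hu.continuous.comp (continuous_const.add continuous_id))
    · obtain ⟨B, hB⟩ := hv.exists_bound hL
      refine intervalIntegral.continuous_of_dominated_interval (bound := fun _ => B)
        (fun z => ?_) (fun z => Eventually.of_forall fun s _ => hB _ s) intervalIntegrable_const
        (Eventually.of_forall fun s _ => ?_)
      · exact (IsControl.measurable_action hL (hγ.add continuous_const).measurable
          hv).aestronglyMeasurable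
      · exact hL.continuous.comp ((continuous_const.add continuous_id).prodMk continuous_const)
  exact fun z => hclosed.closure_subset (Measure.dense_of_ae hgood z)

theorem exists_C11_near_of_isDominated {L : E → E → ℝ} {c C : ℝ} {u : E → ℝ} {K : ℝ≥0}
    (hL : IsTonelliLagrangian L c C) (hu : LipschitzWith K u) (hdom : IsDominated L fun q => -u q)
    {ε : ℝ} (hε : 0 < ε) :
    ∃ (V : E → ℝ) (D : E → E →L[ℝ] ℝ) (B : ℝ), (∀ q, HasFDerivAt V (D q) q) ∧
      (∀ x y, ‖D x - D y‖ ≤ B * ‖x - y‖) ∧ (∀ q w, D q w ≤ L q w) ∧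
      ∀ q, |V q - u q| ≤ ε := by
  have hC := hL.nonneg
  have hc := hL.pos
  set s := ε / (C + 1) with hs
  have hs0 : 0 < s := by positivity
  have hsC : s * C ≤ ε := by
    rw [hs, div_mul_eq_mul_div, div_le_iff₀ (by positivity)]
    nlinarith
  set A := C * (s + 1 / s) with hA
  have hA0 : 0 ≤ A := by positivity
  set r := min s (min 1 (c / (2 * A + 2 * C + 1))) with hr
  have hr0 : 0 < r := by positivity
  have hrs : r ≤ s := min_le_left _ _
  have hr1 : r ≤ 1 := (min_le_right _ _).trans (min_le_left _ _)
  have hrc : r * (2 * A + 2 * C + 1) ≤ c :=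
    (le_div_iff₀ (by positivity)).1 ((min_le_right _ _).trans (min_le_right _ _))
  set W := laxOleinik L s fun q => -u q with hW
  have hWdom : IsDominated L W := hdom.isDominated_laxOleinik hL hs0.le
  set L' : E → E → ℝ := fun q v => L q (-v) with hL'
  have hLr : IsTonelliLagrangian L' c C := hL.reverse
  have hWr : IsDominated L' fun q => -W q := hWdom.reverse
  set V := laxOleinik L' r fun q => -W q with hV
  have hVdom : IsDominated L' V := hWr.isDominated_laxOleinik hLr hr0.le
  have hWA : ∀ q h, -(A * ‖h‖ ^ 2) ≤ -W (q + h) + -W (q - h) - 2 * -W q := fun q h => by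
    have := hdom.laxOleinik_second_le hL hs0 q h
    rw [← hW, ← hA] at this
    linarith
  have hrr : C * r ^ 2 ≤ C * r :=
    mul_le_mul_of_nonneg_left (by nlinarith) hC
  have hV1 := hWr.le_laxOleinik_second hLr hr0.le hA0 hWA (by linarith)
  have hV2 := hWr.laxOleinik_second_le hLr hr0
  rw [← hV] at hV1 hV2
  have hclose : ∀ q, |V q - u q| ≤ ε := by
    intro q
    have a1 := hdom.le_laxOleinik hs0.le q
    have a2 := hdom.laxOleinik_le_add hL hs0.le q
    have a3 := hWr.le_laxOleinik hr0.le q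
    have a4 := hWr.laxOleinik_le_add hLr hr0.le q
    rw [← hW] at a1 a2
    rw [← hV] at a3 a4
    have a5 : r * C ≤ s * C := by gcongr
    exact abs_le.2 ⟨by linarith, by linarith⟩
  set B := 2 * A + 2 * C * r + C * (r + 1 / r) with hB
  have hB1 : 0 ≤ 2 * A + 2 * C * r := by positivity
  have hB2 : 0 ≤ C * (r + 1 / r) := by positivity
  obtain ⟨D, hD⟩ := exists_fderiv_of_second_difference (f := V) (K := B) (fun x h => by
      have b1 := hV1 x h
      have b2 := hV2 x h
      have b3 : 0 ≤ (2 * A + 2 * C * r) * ‖h‖ ^ 2 := by positivity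
      have b4 : 0 ≤ C * (r + 1 / r) * ‖h‖ ^ 2 := by positivity
      rw [hB, add_mul]
      exact abs_le.2 ⟨by linarith, by linarith⟩)
    (fun x => ⟨1, one_pos, ε + (|u x| + K), fun h hh => by
      have b1 := hclose (x + h)
      have b2 := hu.dist_le_mul (x + h) x
      rw [Real.dist_eq, dist_eq_norm, add_sub_cancel_left] at b2
      have b3 : (K : ℝ) * ‖h‖ ≤ K := mul_le_of_le_one_right K.2 hh
      grind⟩)
  have hfd : ∀ q, HasFDerivAt V (D q) q := fun q => hasFDerivAt_of_affine_approx (hD q)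
  refine ⟨V, D, 8 * B, hfd, norm_sub_le_of_affine_approx hD (by positivity), fun q w => ?_, hclose⟩
  have := hVdom.apply_add_nonneg hLr (hfd q) (-w)
  simp only [hL', neg_neg, map_neg] at this
  linarith

end Control

/-- `C^{1,1}` sub-solutions are dense among Lipschitz sub-solutions. -/
theorem exists_C11_subsolution_near {E : Type*} [NormedAddCommGroup E] [InnerProductSpace ℝ E]
    [FiniteDimensional ℝ E] [MeasurableSpace E] [BorelSpace E] {H : E → E → ℝ} {m M a : ℝ}
    (hH : IsTonelliHamiltonian H m M)
    (hconv : ∀ q p, ∃ w, ∀ p', H q p + ⟪p' - p, w⟫ ≤ H q p')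
    {u : E → ℝ} (hu : ∃ K : ℝ≥0, LipschitzWith K u)
    (hsub : ∀ q, DifferentiableAt ℝ u q → H q (gradient u q) ≤ a) {ε : ℝ} (hε : 0 < ε) :
    ∃ v : E → ℝ, Differentiable ℝ v ∧ (∃ K : ℝ≥0, LipschitzWith K fun q => gradient v q) ∧
      (∀ q, H q (gradient v q) ≤ a) ∧ ∀ q, |v q - u q| ≤ ε := by
  obtain ⟨K, hK⟩ := hu
  obtain ⟨c, C, hL⟩ := hH.exists_isTonelliLagrangian a
  have hdom := isDominated_neg_of_subsolution hL hK fun q hq w => by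
    have h1 := hH.inner_sub_le_lagrangian q w (gradient u q)
    have h2 := hsub q hq
    rw [gradient, InnerProductSpace.toDual_symm_apply] at h1
    rw [gradient] at h2
    linarith
  obtain ⟨V, D, B, hfd, hD, hDL, hclose⟩ := exists_C11_near_of_isDominated hL hK hdom hε
  have hgrad : ∀ q, gradient V q = (InnerProductSpace.toDual ℝ E).symm (D q) := fun q => by
    rw [gradient, (hfd q).fderiv]
  refine ⟨V, fun q => (hfd q).differentiableAt, ⟨B.toNNReal, ?_⟩, fun q => ?_, hclose⟩
  · refine LipschitzWith.of_dist_le_mul fun x y => ?_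
    rw [hgrad, hgrad, LinearIsometryEquiv.dist_map, dist_eq_norm, dist_eq_norm]
    exact (hD x y).trans (by gcongr; exact Real.le_coe_toNNReal B)
  · refine le_of_forall_inner_le_lagrangian (hconv q _) fun w => ?_
    rw [hgrad, InnerProductSpace.toDual_symm_apply]
    exact hDL q w

/-- If the stationary Hamilton–Jacobi equation at level `a` admits a
sub-solution, it admits a `C^{1,1}` sub-solution; moreover `C^{1,1}` sub-solutions are dense
(for the uniform distance) in the set of all sub-solutions at level `a`. -/
theorem existence_and_density_of_C11_subsolutions {d : ℕ}
    (H : EuclideanSpace ℝ (Fin d) → EuclideanSpace ℝ (Fin d) → ℝ)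
    (hH : ContDiff ℝ 2 (fun x : EuclideanSpace ℝ (Fin d) × EuclideanSpace ℝ (Fin d) =>
      H x.1 x.2))
    (m M : ℝ) (hm : 0 < m) (hmM : m ≤ M)
    (hd2H : ∀ x : EuclideanSpace ℝ (Fin d) × EuclideanSpace ℝ (Fin d),
      ‖iteratedFDeriv ℝ 2
        (fun y : EuclideanSpace ℝ (Fin d) × EuclideanSpace ℝ (Fin d) => H y.1 y.2) x‖ ≤ M)
    (hconv : ∀ q p v : EuclideanSpace ℝ (Fin d),
      m * ‖v‖ ^ 2 ≤ iteratedFDeriv ℝ 2 (fun p' => H q p') p ![v, v])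
    (hlower : ∀ q p : EuclideanSpace ℝ (Fin d), m / 2 * ‖p‖ ^ 2 - M ≤ H q p)
    (hupper : ∀ q p : EuclideanSpace ℝ (Fin d), H q p ≤ M / 2 * ‖p‖ ^ 2 + M)
    (a : ℝ)
    -- there exists a sub-solution at level `a`
    (hexists : ∃ u : EuclideanSpace ℝ (Fin d) → ℝ,
      (∃ K : ℝ≥0, LipschitzWith K u) ∧
      ∀ q, DifferentiableAt ℝ u q → H q (gradient u q) ≤ a) :
    -- existence of a `C^{1,1}` sub-solution
    (∃ v : EuclideanSpace ℝ (Fin d) → ℝ,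
      Differentiable ℝ v ∧ (∃ K : ℝ≥0, LipschitzWith K (fun q => gradient v q)) ∧
      ∀ q, H q (gradient v q) ≤ a) ∧
    -- density of `C^{1,1}` sub-solutions among sub-solutions
    (∀ u : EuclideanSpace ℝ (Fin d) → ℝ,
      (∃ K : ℝ≥0, LipschitzWith K u) →
      (∀ q, DifferentiableAt ℝ u q → H q (gradient u q) ≤ a) →
      ∀ ε : ℝ, 0 < ε →
        ∃ v : EuclideanSpace ℝ (Fin d) → ℝ,
          Differentiable ℝ v ∧ (∃ K : ℝ≥0, LipschitzWith K (fun q => gradient v q)) ∧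
          (∀ q, H q (gradient v q) ≤ a) ∧
          ∀ q, |v q - u q| ≤ ε) := by
  have hT := isTonelliHamiltonian_of_contDiff hH hm hmM hd2H hconv hlower hupper
  have hsg := exists_subgradient_of_contDiff hH hm.le hconv
  refine ⟨?_, fun u hu hsub ε hε => exists_C11_subsolution_near hT hsg hu hsub hε⟩
  obtain ⟨u, hu, hsub⟩ := hexists
  obtain ⟨v, h1, h2, h3, -⟩ := exists_C11_subsolution_near hT hsg hu hsub one_pos
  exact ⟨v, h1, h2, h3⟩
end

section
/- Let H(q,p) : ℝ^d × ℝ^d → ℝ be a C² autonomous Hamiltonian with ∂²_{pp} H ≥ m·Id in the sense of quadratic forms everywhere, m > 0, and let α ∈ ℝ. Suppose q₀ ∈ ℝ^d is a point such that every C¹ function w : ℝ^d → ℝ satisfying H(x, dw(x)) ≤ α for all x also satisfies H(q₀, dw(q₀)) = α. Then any two C¹ functions u, v : ℝ^d → ℝ satisfying H(x, du(x)) ≤ α and H(x, dv(x)) ≤ α for all x have the same differential at q₀, i.e. du(q₀) = dv(q₀). -/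
open scoped RealInnerProductSpace
open Set

/-- A `C²` function whose second derivative is a positive definite quadratic form at every point
is strictly convex. -/
theorem strictConvexOn_univ_of_iteratedFDeriv_two_pos {E : Type*} [NormedAddCommGroup E]
    [NormedSpace ℝ E] {f : E → ℝ} (hf : ContDiff ℝ 2 f)
    (hpos : ∀ p v : E, v ≠ 0 → 0 < iteratedFDeriv ℝ 2 f p ![v, v]) :
    StrictConvexOn ℝ univ f := by
  refine ⟨convex_univ, fun x _ y _ hxy a b ha hb hab => ?_⟩
  have hline : ∀ t : ℝ, HasDerivAt (fun t : ℝ => x + t • (y - x)) (y - x) t := fun t => by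
    simpa using ((hasDerivAt_id t).smul_const (y - x)).const_add x
  have hderiv : ∀ t : ℝ, HasDerivAt (fun t : ℝ => f (x + t • (y - x)))
      (fderiv ℝ f (x + t • (y - x)) (y - x)) t := fun t =>
    ((hf.differentiable two_ne_zero) _).hasFDerivAt.comp_hasDerivAt t (hline t)
  have hf' : Differentiable ℝ (fderiv ℝ f) :=
    (hf.fderiv_right (m := 1) (by norm_num)).differentiable one_ne_zero
  have hderiv2 : ∀ t : ℝ, HasDerivAt (fun t : ℝ => fderiv ℝ f (x + t • (y - x)) (y - x))
      (fderiv ℝ (fderiv ℝ f) (x + t • (y - x)) (y - x) (y - x)) t := fun t => by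
    simpa using ((hf' _).hasFDerivAt.comp_hasDerivAt t (hline t)).clm_apply
      (hasDerivAt_const t (y - x))
  have hconv : StrictConvexOn ℝ univ (fun t : ℝ => f (x + t • (y - x))) := by
    refine strictConvexOn_of_deriv2_pos' convex_univ
      (fun t _ => (hderiv t).continuousAt.continuousWithinAt) fun t _ => ?_
    have h := hpos (x + t • (y - x)) (y - x) (sub_ne_zero.2 hxy.symm)
    rw [iteratedFDeriv_two_apply] at h
    rw [Function.iterate_succ_apply, Function.iterate_one, funext fun t => (hderiv t).deriv,
      (hderiv2 t).deriv]
    simpa using h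
  have h := hconv.2 (mem_univ 0) (mem_univ 1) zero_ne_one ha hb hab
  have hpt : x + b • (y - x) = a • x + b • y := by
    rw [← eq_sub_iff_add_eq] at hab
    subst hab
    module
  simpa [hpt] using h

/-- The gradient of the average of two differentiable functions is the average of the
gradients. -/
theorem gradient_half_smul_add {E : Type*} [NormedAddCommGroup E] [InnerProductSpace ℝ E]
    [CompleteSpace E] {u v : E → ℝ} {x : E} (hu : DifferentiableAt ℝ u x)
    (hv : DifferentiableAt ℝ v x) :
    gradient (fun y => (1 / 2 : ℝ) • u y + (1 / 2 : ℝ) • v y) x =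
      (1 / 2 : ℝ) • gradient u x + (1 / 2 : ℝ) • gradient v x := by
  have h := (hu.hasFDerivAt.const_smul (1 / 2 : ℝ)).add (hv.hasFDerivAt.const_smul (1 / 2 : ℝ))
  rw [gradient, show fderiv ℝ (fun y => (1 / 2 : ℝ) • u y + (1 / 2 : ℝ) • v y) x = _ from
    h.fderiv]
  simp [gradient]

/-- At a point `q₀` of the projected Aubry set (i.e. a point where every
`C¹` sub-solution at level `α` satisfies `H(q₀, dw(q₀)) = α`), all `C¹` sub-solutions at
level `α` have the same differential. -/
theorem same_differential_on_aubry_set {d : ℕ}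
    (H : EuclideanSpace ℝ (Fin d) → EuclideanSpace ℝ (Fin d) → ℝ)
    (hH : ContDiff ℝ 2 (fun x : EuclideanSpace ℝ (Fin d) × EuclideanSpace ℝ (Fin d) =>
      H x.1 x.2))
    (m : ℝ) (hm : 0 < m)
    -- Hypothesis 2: `∂²ₚₚH ≥ m·Id` in the sense of quadratic forms
    (hconv : ∀ q p v : EuclideanSpace ℝ (Fin d),
      m * ‖v‖ ^ 2 ≤ iteratedFDeriv ℝ 2 (fun p' => H q p') p ![v, v])
    (α : ℝ)
    (q₀ : EuclideanSpace ℝ (Fin d))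
    -- `q₀` belongs to the projected Aubry set
    (hq₀ : ∀ w : EuclideanSpace ℝ (Fin d) → ℝ, ContDiff ℝ 1 w →
      (∀ x, H x (gradient w x) ≤ α) → H q₀ (gradient w q₀) = α)
    (u v : EuclideanSpace ℝ (Fin d) → ℝ)
    (hu : ContDiff ℝ 1 u) (hv : ContDiff ℝ 1 v)
    (hu_sub : ∀ x, H x (gradient u x) ≤ α)
    (hv_sub : ∀ x, H x (gradient v x) ≤ α) :
    gradient u q₀ = gradient v q₀ := by
  have hstrict : ∀ q, StrictConvexOn ℝ univ (H q) := fun q =>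
    strictConvexOn_univ_of_iteratedFDeriv_two_pos
      (hH.comp (contDiff_const.prodMk contDiff_id)) fun p w hw =>
        (by positivity : 0 < m * ‖w‖ ^ 2).trans_le (hconv q p w)
  have hgrad : ∀ x, gradient (fun y => (1 / 2 : ℝ) • u y + (1 / 2 : ℝ) • v y) x =
      (1 / 2 : ℝ) • gradient u x + (1 / 2 : ℝ) • gradient v x := fun x =>
    gradient_half_smul_add (hu.differentiable one_ne_zero x) (hv.differentiable one_ne_zero x)
  have heq := hq₀ (fun y => (1 / 2 : ℝ) • u y + (1 / 2 : ℝ) • v y)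
    ((hu.const_smul _).add (hv.const_smul _)) fun x => by
      have h := (hstrict x).convexOn.2 (mem_univ (gradient u x)) (mem_univ (gradient v x))
        (by norm_num : (0 : ℝ) ≤ 1 / 2) (by norm_num : (0 : ℝ) ≤ 1 / 2) (by norm_num)
      rw [hgrad]
      simp only [smul_eq_mul] at h
      linarith [hu_sub x, hv_sub x]
  by_contra hne
  have h := (hstrict q₀).2 (mem_univ _) (mem_univ _) hne
    (by norm_num : (0 : ℝ) < 1 / 2) (by norm_num : (0 : ℝ) < 1 / 2) (by norm_num)
  rw [← hgrad, heq] at h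
  simp only [smul_eq_mul] at h
  linarith [hu_sub q₀, hv_sub q₀]
end
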